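/- Let G be a d-regular graph on n vertices with d > 0 whose second largest absolute adjacency eigenvalue is at most λ. If X and Y are nonempty disjoint subsets of V(G) with no edges of G between X and Y and |X| ≤ |Y|, then |X| ≤ λn/(d + λ). -/

import Mathlib

open Finset

/-- The adjacency matrix of a simple graph over `ℝ` is Hermitian. -/
theorem adjMatrix_isHermitian {V : Type*} [Fintype V] (G : SimpleGraph V)
    [DecidableRel G.Adj] : (G.adjMatrix ℝ).IsHermitian := by
  unfold Matrix.IsHermitian
  rw [Matrix.conjTranspose_eq_transpose_of_trivial]
  exact G.isSymm_adjMatrix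

/-- The second largest absolute eigenvalue of the adjacency matrix of `G`:
if the eigenvalues are `λ₁ ≥ λ₂ ≥ ... ≥ λₙ`, this is `max_{2 ≤ i ≤ n} |λᵢ|`
(interpreted as `0` when `n ≤ 1`). -/
noncomputable def sndAbsEig {V : Type*} [Fintype V] [DecidableEq V] (G : SimpleGraph V)
    [DecidableRel G.Adj] : ℝ :=
  (((((Multiset.map (adjMatrix_isHermitian G).eigenvalues Finset.univ.val).sort (· ≤ ·)).dropLast).map
    (fun x => |x|)).foldr max 0)

/-- `eAB G A B` is the number of edges of `G` with one end in `A` and the other end in `B`,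
where edges with both ends in `A ∩ B` are counted twice. -/
def eAB {V : Type*} (G : SimpleGraph V) [DecidableRel G.Adj] (A B : Finset V) : ℕ :=
  ∑ a ∈ A, ∑ b ∈ B, if G.Adj a b then 1 else 0

/-- `eIn G A` is the number of edges of `G` with both ends in `A`. -/
noncomputable def eIn {V : Type*} [Fintype V] [DecidableEq V] (G : SimpleGraph V)
    [DecidableRel G.Adj] (A : Finset V) : ℕ :=
  letI := Classical.dec
  (G.edgeFinset.filter (fun e => ∀ v ∈ e, v ∈ A)).card

/-- The number of connected components of the graph obtained from `G`
by deleting the vertices of `S`. -/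
noncomputable def numComp {V : Type*} [Fintype V] [DecidableEq V] (G : SimpleGraph V)
    (S : Finset V) : ℕ :=
  Nat.card (G.induce ((Sᶜ : Finset V) : Set V)).ConnectedComponent

open Matrix in
/-- The coordinate of `u` along the `i`-th eigenvector of a real Hermitian matrix. -/
noncomputable def eigenCoord {V : Type*} [Fintype V] [DecidableEq V] {A : Matrix V V ℝ}
    (hA : A.IsHermitian) (u : V → ℝ) (i : V) : ℝ :=
  (hA.eigenvectorBasis i).ofLp ⬝ᵥ u

open Matrix in
theorem eigenCoord_mulVec {V : Type*} [Fintype V] [DecidableEq V] {A : Matrix V V ℝ}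
    (hA : A.IsHermitian) (u : V → ℝ) (i : V) :
    eigenCoord hA (A *ᵥ u) i = hA.eigenvalues i * eigenCoord hA u i := by
  have hT : Aᵀ = A := by
    rw [← conjTranspose_eq_transpose_of_trivial]
    exact hA
  unfold eigenCoord
  rw [dotProduct_mulVec, ← mulVec_transpose, hT, hA.mulVec_eigenvectorBasis, smul_dotProduct,
    smul_eq_mul]

open Matrix in
/-- Parseval's identity in the eigenbasis of a real Hermitian matrix. -/
theorem sum_eigenCoord_mul {V : Type*} [Fintype V] [DecidableEq V] {A : Matrix V V ℝ}
    (hA : A.IsHermitian) (u w : V → ℝ) :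
    ∑ i, eigenCoord hA u i * eigenCoord hA w i = u ⬝ᵥ w := by
  have h := hA.eigenvectorBasis.sum_inner_mul_inner (WithLp.toLp 2 u) (WithLp.toLp 2 w)
  simp only [EuclideanSpace.inner_eq_star_dotProduct, star_trivial] at h
  rw [dotProduct_comm u w, ← h]
  refine Finset.sum_congr rfl fun i _ => ?_
  unfold eigenCoord
  rw [dotProduct_comm w]

theorem List.le_foldr_max {α : Type*} [LinearOrder α] (l : List α) (b : α) {a : α} (h : a ∈ l) :
    a ≤ l.foldr max b := by
  induction l with
  | nil => simp at h
  | cons c t ih =>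
    rcases List.mem_cons.1 h with rfl | h
    · exact le_max_left _ _
    · exact (ih h).trans (le_max_right _ _)

theorem List.base_le_foldr_max {α : Type*} [LinearOrder α] (l : List α) (b : α) :
    b ≤ l.foldr max b := by
  induction l with
  | nil => exact le_rfl
  | cons c t ih => exact ih.trans (le_max_right _ _)

theorem sndAbsEig_nonneg {V : Type*} [Fintype V] [DecidableEq V] (G : SimpleGraph V)
    [DecidableRel G.Adj] : 0 ≤ sndAbsEig G :=
  List.base_le_foldr_max _ _

/-- All adjacency eigenvalues but one are bounded in absolute value by `sndAbsEig G`. -/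
theorem exists_forall_ne_abs_eigenvalues_le {V : Type*} [Fintype V] [DecidableEq V] [Nonempty V]
    (G : SimpleGraph V) [DecidableRel G.Adj] :
    ∃ i₀, ∀ i, i ≠ i₀ → |(adjMatrix_isHermitian G).eigenvalues i| ≤ sndAbsEig G := by
  set μ := (adjMatrix_isHermitian G).eigenvalues
  set l := (Multiset.map μ Finset.univ.val).sort (· ≤ ·)
  have hcoe : (l : Multiset ℝ) = Multiset.map μ Finset.univ.val := Multiset.sort_eq _ _
  have hne : l ≠ [] := by
    intro h
    rw [h] at hcoe
    have hcard := congrArg Multiset.card hcoe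
    simp [eq_comm, Fintype.card_ne_zero] at hcard
  have hlast : l.getLast hne ∈ Multiset.map μ Finset.univ.val := by
    rw [← hcoe]
    exact List.getLast_mem hne
  obtain ⟨i₀, -, hi₀⟩ := Multiset.mem_map.1 hlast
  have hcons : l.getLast hne ::ₘ (l.dropLast : Multiset ℝ) =
      μ i₀ ::ₘ Multiset.map μ (Finset.univ.val.erase i₀) := by
    rw [← Multiset.map_cons, Multiset.cons_erase (Finset.mem_univ i₀), ← hcoe,
      Multiset.cons_coe, Multiset.coe_eq_coe]
    conv_rhs => rw [← List.dropLast_append_getLast hne]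
    exact (List.perm_append_singleton _ _).symm
  rw [hi₀, Multiset.cons_inj_right] at hcons
  refine ⟨i₀, fun i hi => List.le_foldr_max _ _ (List.mem_map_of_mem ?_)⟩
  change μ i ∈ l.dropLast
  rw [← Multiset.mem_coe, hcons]
  exact Multiset.mem_map_of_mem _ ((Multiset.mem_erase_of_ne hi).2 (Finset.mem_univ i))

open Matrix in
/-- If there are no edges between `X` and `Y` in a `d`-regular graph all of whose nontrivial
eigenvalues are at most `lam < d` in absolute value, then
`d ^ 2 |X| |Y| ≤ lam ^ 2 (n - |X|) (n - |Y|)`. -/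
theorem sq_degree_mul_card_mul_card_le
    {V : Type*} [Fintype V] [DecidableEq V] (G : SimpleGraph V) [DecidableRel G.Adj]
    (d : ℕ) (lam : ℝ) (hreg : G.IsRegularOfDegree d) (hlam : sndAbsEig G ≤ lam) (hlt : lam < d)
    (X Y : Finset V) (hX : X.Nonempty) (hY : Y.Nonempty)
    (hnoedge : ∀ x ∈ X, ∀ y ∈ Y, ¬ G.Adj x y) :
    (d : ℝ) ^ 2 * (X.card * Y.card) ≤
      lam ^ 2 * ((Fintype.card V - X.card) * (Fintype.card V - Y.card)) := by
  have hV : Nonempty V := ⟨hX.choose⟩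
  obtain ⟨i₀, hi₀⟩ := exists_forall_ne_abs_eigenvalues_le G
  set hA := adjMatrix_isHermitian G
  set μ := hA.eigenvalues
  let ind : Finset V → V → ℝ := fun S v => if v ∈ S then 1 else 0
  let o : V → ℝ := fun _ => 1
  have hAo : G.adjMatrix ℝ *ᵥ o = (d : ℝ) • o := by
    ext v
    simp [o, SimpleGraph.adjMatrix_mulVec_apply, hreg.degree_eq v]
  have hoi : ∀ i, μ i * eigenCoord hA o i = d * eigenCoord hA o i := by
    intro i
    rw [← eigenCoord_mulVec, hAo]
    simp [eigenCoord, dotProduct_smul]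
  have ho : ∀ i, i ≠ i₀ → eigenCoord hA o i = 0 := by
    intro i hi
    by_contra h
    have := mul_right_cancel₀ h (hoi i)
    have := le_abs_self (μ i)
    linarith [hi₀ i hi]
  have hsplit : ∀ f : V → ℝ, ∑ i, f i = f i₀ + ∑ i ∈ Finset.univ.erase i₀, f i :=
    fun f => (Finset.add_sum_erase _ f (Finset.mem_univ i₀)).symm
  have hproj : ∀ u, eigenCoord hA u i₀ * eigenCoord hA o i₀ = u ⬝ᵥ o := by
    intro u
    rw [← sum_eigenCoord_mul hA, hsplit, Finset.sum_eq_zero, add_zero]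
    intro i hi
    rw [ho i (Finset.ne_of_mem_erase hi), mul_zero]
  have hn : (0 : ℝ) < Fintype.card V := by exact_mod_cast Fintype.card_pos
  have hoo : eigenCoord hA o i₀ * eigenCoord hA o i₀ = Fintype.card V := by
    rw [hproj]
    simp [o, dotProduct]
  have hindo : ∀ S : Finset V, eigenCoord hA (ind S) i₀ * eigenCoord hA o i₀ = S.card := by
    intro S
    rw [hproj]
    simp [o, ind, dotProduct]
  have ho0 : eigenCoord hA o i₀ ≠ 0 := by
    intro h
    rw [h] at hoo
    linarith
  have hμ₀ : μ i₀ = d := mul_right_cancel₀ ho0 (hoi i₀)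
  have hprod : ∀ S T : Finset V, eigenCoord hA (ind S) i₀ * eigenCoord hA (ind T) i₀ *
      Fintype.card V = S.card * T.card := by
    intro S T
    rw [← hindo, ← hindo, ← hoo]
    ring
  have hnorm : ∀ S : Finset V, (Fintype.card V : ℝ) *
      ∑ i ∈ Finset.univ.erase i₀, eigenCoord hA (ind S) i ^ 2 =
        S.card * (Fintype.card V - S.card) := by
    intro S
    have h := sum_eigenCoord_mul hA (ind S) (ind S)
    rw [hsplit] at h
    have hS : ind S ⬝ᵥ ind S = S.card := by simp [ind, dotProduct]
    simp only [← pow_two] at h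
    rw [hS] at h
    have := hprod S S
    linear_combination (Fintype.card V : ℝ) * h - this
  have hzero : ind X ⬝ᵥ (G.adjMatrix ℝ *ᵥ ind Y) = 0 := by
    refine Finset.sum_eq_zero fun x _ => ?_
    by_cases hx : x ∈ X
    · rw [SimpleGraph.adjMatrix_mulVec_apply, Finset.sum_eq_zero, mul_zero]
      intro y hy
      rw [SimpleGraph.mem_neighborFinset] at hy
      exact if_neg fun hyY => hnoedge x hx y hyY hy
    · simp [ind, hx]
  rw [← sum_eigenCoord_mul hA, hsplit, eigenCoord_mulVec] at hzero
  simp only [eigenCoord_mulVec] at hzero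
  change _ * (μ i₀ * _) + _ = 0 at hzero
  rw [hμ₀] at hzero
  set x := eigenCoord hA (ind X)
  set y := eigenCoord hA (ind Y)
  set R := ∑ i ∈ Finset.univ.erase i₀, x i * (μ i * y i)
  have hCS : R ^ 2 ≤ (∑ i ∈ Finset.univ.erase i₀, x i ^ 2) *
      (lam ^ 2 * ∑ i ∈ Finset.univ.erase i₀, y i ^ 2) := by
    refine (Finset.sum_mul_sq_le_sq_mul_sq _ _ _).trans ?_
    refine mul_le_mul_of_nonneg_left ?_ (Finset.sum_nonneg fun i _ => sq_nonneg _)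
    rw [Finset.mul_sum]
    refine Finset.sum_le_sum fun i hi => ?_
    rw [mul_pow]
    refine mul_le_mul_of_nonneg_right ?_ (sq_nonneg _)
    exact sq_le_sq' (by linarith [hi₀ i (Finset.ne_of_mem_erase hi), neg_abs_le (μ i)])
      ((le_abs_self _).trans ((hi₀ i (Finset.ne_of_mem_erase hi)).trans hlam))
  have hR : Fintype.card V * R = -(d * (X.card * Y.card)) := by
    linear_combination (Fintype.card V : ℝ) * hzero - d * hprod X Y
  have hXpos : (0 : ℝ) < X.card := by exact_mod_cast hX.card_pos
  have hYpos : (0 : ℝ) < Y.card := by exact_mod_cast hY.card_pos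
  refine le_of_mul_le_mul_left ?_ (mul_pos hXpos hYpos)
  calc (X.card * Y.card : ℝ) * (d ^ 2 * (X.card * Y.card))
      = (Fintype.card V * R) ^ 2 := by rw [hR]; ring
    _ = (Fintype.card V : ℝ) ^ 2 * R ^ 2 := by ring
    _ ≤ (Fintype.card V : ℝ) ^ 2 * ((∑ i ∈ Finset.univ.erase i₀, x i ^ 2) *
      (lam ^ 2 * ∑ i ∈ Finset.univ.erase i₀, y i ^ 2)) :=
        mul_le_mul_of_nonneg_left hCS (sq_nonneg _)
    _ = lam ^ 2 * ((Fintype.card V * ∑ i ∈ Finset.univ.erase i₀, x i ^ 2) *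
      (Fintype.card V * ∑ i ∈ Finset.univ.erase i₀, y i ^ 2)) := by ring
    _ = _ := by rw [hnorm X, hnorm Y]; ring

theorem smaller_side_bound
    {V : Type*} [Fintype V] [DecidableEq V] (G : SimpleGraph V) [DecidableRel G.Adj]
    (n d : ℕ) (lam : ℝ) (hn : Fintype.card V = n) (hd : 0 < d)
    (hreg : G.IsRegularOfDegree d) (hlam : sndAbsEig G ≤ lam)
    (X Y : Finset V) (hX : X.Nonempty) (hY : Y.Nonempty) (hXY : Disjoint X Y)
    (hnoedge : ∀ x ∈ X, ∀ y ∈ Y, ¬ G.Adj x y) (hle : X.card ≤ Y.card) :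
    (X.card : ℝ) ≤ lam * (n : ℝ) / ((d : ℝ) + lam) := by
  have hlam0 : 0 ≤ lam := (sndAbsEig_nonneg G).trans hlam
  have hd0 : (0 : ℝ) < d := by exact_mod_cast hd
  have hcard : (X.card : ℝ) + Y.card ≤ n := by
    rw [← hn]
    exact_mod_cast (Finset.card_union_of_disjoint hXY).symm.trans_le (Finset.card_le_univ _)
  have hle' : (X.card : ℝ) ≤ Y.card := by exact_mod_cast hle
  have hX0 : (0 : ℝ) ≤ X.card := Nat.cast_nonneg _
  rw [le_div_iff₀ (by linarith)]
  suffices h : d * (X.card : ℝ) ≤ lam * (n - X.card) by linarith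
  rcases le_or_gt (d : ℝ) lam with h | h
  · exact mul_le_mul h (by linarith) hX0 hlam0
  · have key := sq_degree_mul_card_mul_card_le G d lam hreg hlam h X Y hX hY hnoedge
    rw [hn] at key
    refine (pow_le_pow_iff_left₀ (by positivity) (mul_nonneg hlam0 (by linarith)) two_ne_zero).1 ?_
    calc ((d : ℝ) * X.card) ^ 2 = (d : ℝ) ^ 2 * (X.card * X.card) := by ring
      _ ≤ (d : ℝ) ^ 2 * (X.card * Y.card) := by gcongr
      _ ≤ lam ^ 2 * ((n - X.card) * (n - Y.card)) := key
      _ ≤ lam ^ 2 * ((n - X.card) * (n - X.card)) := by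
        gcongr
        linarith
      _ = (lam * (n - X.card)) ^ 2 := by ring
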